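/- arXiv:0808.0317 — 2 statements merged into one kernel-verified Lean document; each statement's English description precedes it below -/
import Mathlib

section
/- Let ν > 0 and let f, g : (0,∞) → ℝ be measurable such that the function (x,u,y) ↦ y^(2ν−1)·x·exp(−x²y²)·|f(x)|·u·exp(−u²y²)·|g(u)| is integrable on (0,∞)³. Then the Parseval–Goldstein type identity ∫₀^∞ x·f(x)·P_{ν,2}{g}(x) dx = ∫₀^∞ u·g(u)·P_{ν,2}{f}(u) du holds. -/
open MeasureTheory Real Set

/-- The kernel `(x² + u²)^(-ν)` as a Gaussian moment. -/
theorem integral_rpow_mul_exp_mul_exp {ν x u : ℝ} (hν : 0 < ν) (hx : 0 < x) :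
    ∫ y in Ioi (0 : ℝ), y ^ (2 * ν - 1) * (exp (-(x ^ 2) * y ^ 2) * exp (-(u ^ 2) * y ^ 2)) =
      Gamma ν / 2 * ((x ^ 2 + u ^ 2) ^ ν)⁻¹ := by
  have hb : 0 < x ^ 2 + u ^ 2 := by positivity
  have h := integral_rpow_mul_exp_neg_mul_rpow (p := 2) (q := 2 * ν - 1) two_pos (by linarith) hb
  rw [show -(2 * ν - 1 + 1) / 2 = -ν by ring, show (2 * ν - 1 + 1) / 2 = ν by ring,
    rpow_neg hb.le] at h
  calc _ = ∫ y in Ioi (0 : ℝ), y ^ (2 * ν - 1) * exp (-(x ^ 2 + u ^ 2) * y ^ (2 : ℝ)) := by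
        refine integral_congr_ae (.of_forall fun y => ?_)
        simp only [← exp_add, rpow_two]
        ring_nf
    _ = _ := by rw [h]; ring

/-- Absolute convergence of the Gaussian triple integral implies that of the double integral
against the kernel `(x² + u²)^(-ν)`. -/
theorem integrable_mul_div_rpow_of_integrableOn_gaussian {ν : ℝ} (hν : 0 < ν) {f g : ℝ → ℝ}
    (hf : AEMeasurable f (volume.restrict (Ioi 0)))
    (hg : AEMeasurable g (volume.restrict (Ioi 0)))
    (hint : IntegrableOn
      (fun p : ℝ × ℝ × ℝ =>
        p.2.2 ^ (2 * ν - 1) * (p.1 * exp (-(p.1 ^ 2) * p.2.2 ^ 2) * |f p.1|) *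
          (p.2.1 * exp (-(p.2.1 ^ 2) * p.2.2 ^ 2) * |g p.2.1|))
      (Ioi 0 ×ˢ Ioi 0 ×ˢ Ioi 0)) :
    Integrable (fun z : ℝ × ℝ => z.1 * f z.1 * (z.2 * g z.2) / (z.1 ^ 2 + z.2 ^ 2) ^ ν)
      ((volume.restrict (Ioi 0)).prod (volume.restrict (Ioi 0))) := by
  set μ : Measure ℝ := volume.restrict (Ioi 0) with hμ
  have hvol : (volume : Measure (ℝ × ℝ × ℝ)).restrict (Ioi 0 ×ˢ Ioi 0 ×ˢ Ioi 0) =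
      μ.prod (μ.prod μ) := by
    simp only [hμ, Measure.prod_restrict, Measure.volume_eq_prod]
  rw [IntegrableOn, hvol] at hint
  have hassoc := (measurePreserving_prodAssoc μ μ μ).integrable_comp_of_integrable hint
  have hΓ : 0 < Gamma ν := Gamma_pos_of_pos hν
  refine (hassoc.integral_prod_left.const_mul (2 / Gamma ν)).mono' ?_ ?_
  · have hf' : AEMeasurable (fun z : ℝ × ℝ => f z.1) (μ.prod μ) := hf.comp_fst
    have hg' : AEMeasurable (fun z : ℝ × ℝ => g z.2) (μ.prod μ) := hg.comp_snd
    exact AEMeasurable.aestronglyMeasurable (by fun_prop)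
  · have hpos : ∀ᵐ z ∂μ.prod μ, z ∈ Ioi (0 : ℝ) ×ˢ Ioi (0 : ℝ) := by
      rw [hμ, Measure.prod_restrict]
      exact ae_restrict_mem (measurableSet_Ioi.prod measurableSet_Ioi)
    filter_upwards [hpos] with ⟨x, u⟩ ⟨hx, hu⟩
    have hx : 0 < x := hx
    have hu : 0 < u := hu
    have hkernel : ∫ y in Ioi (0 : ℝ), y ^ (2 * ν - 1) * (x * exp (-(x ^ 2) * y ^ 2) * |f x|) *
        (u * exp (-(u ^ 2) * y ^ 2) * |g u|) =
        x * |f x| * (u * |g u|) * (Gamma ν / 2 * ((x ^ 2 + u ^ 2) ^ ν)⁻¹) := by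
      rw [← integral_rpow_mul_exp_mul_exp hν hx, ← integral_const_mul]
      exact integral_congr_ae (.of_forall fun y => by ring)
    refine le_of_eq (Eq.trans ?_ (congrArg (2 / Gamma ν * ·) hkernel).symm)
    have hk : 0 < (x ^ 2 + u ^ 2) ^ ν := by positivity
    simp only [norm_div, norm_mul, norm_eq_abs, abs_of_pos hx, abs_of_pos hu, abs_of_pos hk]
    field_simp

/-- Parseval–Goldstein type identity for the `P_{ν,2}`-transform:
`∫₀^∞ x f(x) P_{ν,2}{g}(x) dx = ∫₀^∞ u g(u) P_{ν,2}{f}(u) du`. -/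
theorem parseval_goldstein_Pnu2 (ν : ℝ) (hν : 0 < ν) (f g : ℝ → ℝ)
    (hf : AEMeasurable f (volume.restrict (Ioi 0)))
    (hg : AEMeasurable g (volume.restrict (Ioi 0)))
    (hint : IntegrableOn
      (fun p : ℝ × ℝ × ℝ =>
        p.2.2 ^ (2 * ν - 1) * (p.1 * Real.exp (-(p.1 ^ 2) * p.2.2 ^ 2) * |f p.1|) *
          (p.2.1 * Real.exp (-(p.2.1 ^ 2) * p.2.2 ^ 2) * |g p.2.1|))
      (Ioi 0 ×ˢ Ioi 0 ×ˢ Ioi 0)) :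
    ∫ x in Ioi (0 : ℝ),
        x * f x * ∫ u in Ioi (0 : ℝ), u * g u / (u ^ 2 + x ^ 2) ^ ν
      = ∫ u in Ioi (0 : ℝ),
          u * g u * ∫ x in Ioi (0 : ℝ), x * f x / (x ^ 2 + u ^ 2) ^ ν := by
  have h := integral_integral_swap
    (f := fun x u => x * f x * (u * g u) / (x ^ 2 + u ^ 2) ^ ν)
    (integrable_mul_div_rpow_of_integrableOn_gaussian hν hf hg hint)
  simp only [← integral_const_mul]
  calc _ = _ := by
        refine integral_congr_ae (.of_forall fun x => integral_congr_ae (.of_forall fun u => ?_))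
        simp only [add_comm (u ^ 2), mul_div_assoc]
    _ = _ := h
    _ = _ := by
        refine integral_congr_ae (.of_forall fun u => integral_congr_ae (.of_forall fun x => ?_))
        ring
end

section
/- Let f, g : (0,∞) → ℝ be measurable such that the function (x,u,y) ↦ y·x·exp(−x²y²)·|f(x)|·u·exp(−u²y²)·|g(u)| is integrable on (0,∞)³. Then ∫₀^∞ y·L₂{f}(y)·L₂{g}(y) dy = (1/2)·∫₀^∞ u·g(u)·P{f}(u) du. -/
open MeasureTheory Real Set

theorem integral_Ioi_mul_exp_neg_mul_sq {b : ℝ} (hb : 0 < b) :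
    ∫ y in Ioi (0 : ℝ), y * Real.exp (-b * y ^ 2) = (2 * b)⁻¹ := by
  have h := integral_mul_cexp_neg_mul_sq (b := (b : ℂ)) (by simpa using hb)
  apply Complex.ofReal_injective
  rw [← integral_complex_ofReal]
  push_cast
  exact h

/-- Parseval–Goldstein type relation:
`∫₀^∞ y L₂{f}(y) L₂{g}(y) dy = (1/2) ∫₀^∞ u g(u) P{f}(u) du`,
where `P` is the Widder potential transform. -/
theorem parseval_goldstein_L2_widder_right (f g : ℝ → ℝ)
    (hf : AEMeasurable f (volume.restrict (Ioi 0)))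
    (hg : AEMeasurable g (volume.restrict (Ioi 0)))
    (hint : IntegrableOn
      (fun p : ℝ × ℝ × ℝ =>
        p.2.2 * (p.1 * Real.exp (-(p.1 ^ 2) * p.2.2 ^ 2) * |f p.1|) *
          (p.2.1 * Real.exp (-(p.2.1 ^ 2) * p.2.2 ^ 2) * |g p.2.1|))
      (Ioi 0 ×ˢ Ioi 0 ×ˢ Ioi 0)) :
    ∫ y in Ioi (0 : ℝ),
        y * (∫ x in Ioi (0 : ℝ), x * Real.exp (-(x ^ 2) * y ^ 2) * f x) *
          ∫ u in Ioi (0 : ℝ), u * Real.exp (-(u ^ 2) * y ^ 2) * g u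
      = (1 / 2) *
          ∫ u in Ioi (0 : ℝ),
            u * g u * ∫ x in Ioi (0 : ℝ), x * f x / (x ^ 2 + u ^ 2) := by
  set μ : Measure ℝ := volume.restrict (Ioi 0) with hμ
  have habs : Integrable (fun p : ℝ × ℝ × ℝ =>
        p.2.2 * (p.1 * Real.exp (-(p.1 ^ 2) * p.2.2 ^ 2) * |f p.1|) *
          (p.2.1 * Real.exp (-(p.2.1 ^ 2) * p.2.2 ^ 2) * |g p.2.1|))
      (μ.prod (μ.prod μ)) := by
    rw [hμ, Measure.prod_restrict, Measure.prod_restrict]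
    exact hint
  let F : (ℝ × ℝ) × ℝ → ℝ := fun p =>
    p.2 * ((p.1.1 * Real.exp (-(p.1.1 ^ 2) * p.2 ^ 2) * f p.1.1) *
      (p.1.2 * Real.exp (-(p.1.2 ^ 2) * p.2 ^ 2) * g p.1.2))
  have hF : Integrable F ((μ.prod μ).prod μ) := by
    have habs' := (measurePreserving_prodAssoc μ μ μ).integrable_comp_of_integrable habs
    refine habs'.mono ?_ (Filter.Eventually.of_forall fun p => ?_)
    · have hf' : AEMeasurable (fun p : (ℝ × ℝ) × ℝ => f p.1.1) ((μ.prod μ).prod μ) :=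
        hf.comp_quasiMeasurePreserving
          (Measure.quasiMeasurePreserving_fst.comp Measure.quasiMeasurePreserving_fst)
      have hg' : AEMeasurable (fun p : (ℝ × ℝ) × ℝ => g p.1.2) ((μ.prod μ).prod μ) :=
        hg.comp_quasiMeasurePreserving
          (Measure.quasiMeasurePreserving_snd.comp Measure.quasiMeasurePreserving_fst)
      have hx : AEMeasurable (fun p : (ℝ × ℝ) × ℝ =>
          p.1.1 * Real.exp (-(p.1.1 ^ 2) * p.2 ^ 2)) ((μ.prod μ).prod μ) := by fun_prop
      have hu : AEMeasurable (fun p : (ℝ × ℝ) × ℝ =>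
          p.1.2 * Real.exp (-(p.1.2 ^ 2) * p.2 ^ 2)) ((μ.prod μ).prod μ) := by fun_prop
      exact (measurable_snd.aemeasurable.mul
        ((hx.mul hf').mul (hu.mul hg'))).aestronglyMeasurable
    · simp [F, MeasurableEquiv.prodAssoc, mul_assoc]
  have hinner : ∀ u ∈ Ioi (0 : ℝ), ∫ x, ∫ y, F ((x, u), y) ∂μ ∂μ
      = (1 / 2) * (u * g u * ∫ x, x * f x / (x ^ 2 + u ^ 2) ∂μ) := by
    intro u hu
    rw [← integral_const_mul, ← integral_const_mul]
    refine integral_congr_ae (Filter.Eventually.of_forall fun x => ?_)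
    have hb : 0 < x ^ 2 + u ^ 2 := by
      have : 0 < u := hu
      positivity
    calc ∫ y, F ((x, u), y) ∂μ
        = ∫ y, x * f x * (u * g u) * (y * Real.exp (-(x ^ 2 + u ^ 2) * y ^ 2)) ∂μ := by
          congr 1 with y
          simp only [F]
          rw [neg_add, add_mul, Real.exp_add]
          ring
      _ = 1 / 2 * (u * g u * (x * f x / (x ^ 2 + u ^ 2))) := by
          rw [integral_const_mul, integral_Ioi_mul_exp_neg_mul_sq hb]
          field_simp
  calc _ = ∫ y, ∫ q, F (q, y) ∂(μ.prod μ) ∂μ := by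
        congr 1 with y
        simp only [F]
        rw [integral_const_mul, mul_assoc, ← integral_prod_mul]
    _ = ∫ q, ∫ y, F (q, y) ∂μ ∂(μ.prod μ) := by
        rw [← integral_prod_symm F hF, integral_prod F hF]
    _ = ∫ u, ∫ x, ∫ y, F ((x, u), y) ∂μ ∂μ ∂μ :=
        integral_prod_symm _ hF.integral_prod_left
    _ = _ := by
        rw [← integral_const_mul]
        exact setIntegral_congr_fun measurableSet_Ioi hinner
end
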